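/- Let E be an elliptic curve over ℚ given by a Weierstrass equation with coefficients in ℤ, let P ∈ E(ℚ) be an affine point, and let γ ∈ ℚ* be such that γ^{n²−1}·F_n(P) ∈ ℤ for all n ≥ 1. If p is a prime such that the discriminant of the Weierstrass equation is not divisible by p (good reduction at p), then ord_p(γ) ≥ 0. -/

import Mathlib

open WeierstrassCurve Polynomial

/-- On a Weierstrass curve, the third division polynomial is `-(∂F/∂X)²` modulo `∂F/∂Y`, so a point
at which both `ψ₂` and `Ψ₃` vanish is singular. -/
lemma not_nonsingular_of_ψ₂_of_Ψ₃ {F : Type*} [Field F] (W : WeierstrassCurve F)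
    {x y : F} (h2 : 2 * y + W.a₁ * x + W.a₃ = 0)
    (h3 : 3 * x ^ 4 + W.b₂ * x ^ 3 + 3 * W.b₄ * x ^ 2 + 3 * W.b₆ * x + W.b₈ = 0) :
    ¬ W.toAffine.Nonsingular x y := by
  intro h
  rw [Affine.nonsingular_iff', Affine.equation_iff'] at h
  obtain ⟨heq, hX | hY⟩ := h
  · apply hX
    rw [← sq_eq_zero_iff]
    simp only [b₂, b₄, b₆, b₈] at h3
    linear_combination -h3 + (W.a₁ * (W.a₁ * y - (3 * x ^ 2 + 2 * W.a₂ * x + W.a₄)) +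
      (W.a₂ + 3 * x) * (2 * y + W.a₁ * x + W.a₃)) * h2 - (12 * x + W.a₁ ^ 2 + 4 * W.a₂) * heq
  · exact hY h2

lemma norm_lt_one_of_norm_pow_mul_le_one {K : Type*} [NormedField K] {c a : K} {k : ℕ}
    (hk : k ≠ 0) (hc : 1 < ‖c‖) (h : ‖c ^ k * a‖ ≤ 1) : ‖a‖ < 1 := by
  rw [norm_mul, norm_pow] at h
  have := one_lt_pow₀ hc hk
  by_contra! ha
  nlinarith

lemma PadicInt.toZMod_eq_zero_of_norm_lt_one {p : ℕ} [Fact p.Prime] {z : ℤ_[p]} (h : ‖z‖ < 1) :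
    PadicInt.toZMod z = 0 := by
  rw [← RingHom.mem_ker, PadicInt.ker_toZMod, IsLocalRing.mem_maximalIdeal]
  exact PadicInt.mem_nonunits.mpr h

/-- If `x, y` are the `p`-adic coordinates of a point on an integral Weierstrass curve and both
`ψ₂` and `Ψ₃` lie in the maximal ideal there, then the discriminant is divisible by `p`. -/
lemma Δ_dvd_of_norm_lt_one (W : WeierstrassCurve ℤ) (p : ℕ) [Fact p.Prime] {x y : ℚ_[p]}
    (heq : y ^ 2 + W.a₁ * x * y + W.a₃ * y = x ^ 3 + W.a₂ * x ^ 2 + W.a₄ * x + W.a₆)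
    (h2 : ‖2 * y + W.a₁ * x + W.a₃‖ < 1)
    (h3 : ‖3 * x ^ 4 + W.b₂ * x ^ 3 + 3 * W.b₄ * x ^ 2 + 3 * W.b₆ * x + W.b₈‖ < 1) :
    (p : ℤ) ∣ W.Δ := by
  obtain ⟨f, hf⟩ : ∃ f : ℤ_[p], (f : ℚ_[p]) = 2 * y + W.a₁ * x + W.a₃ := ⟨⟨_, h2.le⟩, rfl⟩
  obtain ⟨g, hg⟩ : ∃ g : ℤ_[p], (g : ℚ_[p]) =
    3 * x ^ 4 + W.b₂ * x ^ 3 + 3 * W.b₄ * x ^ 2 + 3 * W.b₆ * x + W.b₈ := ⟨⟨_, h3.le⟩, rfl⟩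
  have hf0 : PadicInt.toZMod f = 0 :=
    PadicInt.toZMod_eq_zero_of_norm_lt_one (by rwa [PadicInt.norm_def, hf])
  have hg0 : PadicInt.toZMod g = 0 :=
    PadicInt.toZMod_eq_zero_of_norm_lt_one (by rwa [PadicInt.norm_def, hg])
  have inv_mem {t : ℚ_[p]} (ht : 1 < ‖t‖) :
      ∃ u : ℤ_[p], (u : ℚ_[p]) * t = 1 ∧ PadicInt.toZMod u = 0 := by
    have hu : ‖t⁻¹‖ < 1 := by rw [norm_inv]; exact inv_lt_one_of_one_lt₀ ht
    exact ⟨⟨t⁻¹, hu.le⟩, inv_mul_cancel₀ (norm_pos_iff.mp (by linarith)),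
      PadicInt.toZMod_eq_zero_of_norm_lt_one hu⟩
  have coe_ofNat (n : ℕ) [n.AtLeastTwo] : ((ofNat(n) : ℤ_[p]) : ℚ_[p]) = ofNat(n) :=
    map_ofNat PadicInt.Coe.ringHom n
  rcases lt_or_ge 1 ‖x‖ with hx | hx
  · exfalso
    obtain ⟨u, hu, hu0⟩ := inv_mem hx
    have e3 : g * u ^ 4 = 3 + W.b₂ * u + 3 * W.b₄ * u ^ 2 + 3 * W.b₆ * u ^ 3 + W.b₈ * u ^ 4 := by
      apply PadicInt.ext
      push_cast [coe_ofNat]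
      have hx0 : x ≠ 0 := right_ne_zero_of_mul_eq_one hu
      rw [hg, eq_inv_of_mul_eq_one_left hu]
      field_simp
    have e2 : f ^ 2 * u ^ 3 = 4 + W.b₂ * u + 2 * W.b₄ * u ^ 2 + W.b₆ * u ^ 3 := by
      apply PadicInt.ext
      push_cast [coe_ofNat]
      have hx0 : x ≠ 0 := right_ne_zero_of_mul_eq_one hu
      rw [hf, eq_inv_of_mul_eq_one_left hu]
      simp only [b₂, b₄, b₆]
      push_cast
      field_simp
      linear_combination 4 * heq
    have m3 := congrArg PadicInt.toZMod e3
    have m2 := congrArg PadicInt.toZMod e2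
    simp only [map_add, map_mul, map_pow, map_intCast, map_ofNat, hu0, hf0, hg0] at m2 m3
    exact one_ne_zero (α := ZMod p) (by linear_combination m3 - m2)
  obtain ⟨X, rfl⟩ : ∃ X : ℤ_[p], (X : ℚ_[p]) = x := ⟨⟨x, hx⟩, rfl⟩
  rcases lt_or_ge 1 ‖y‖ with hy | hy
  · exfalso
    obtain ⟨u, hu, hu0⟩ := inv_mem hy
    have e : 1 + W.a₁ * X * u + W.a₃ * u =
        (X ^ 3 + W.a₂ * X ^ 2 + W.a₄ * X + W.a₆) * u ^ 2 := by
      apply PadicInt.ext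
      push_cast
      have hy0 : y ≠ 0 := right_ne_zero_of_mul_eq_one hu
      rw [eq_inv_of_mul_eq_one_left hu]
      field_simp
      linear_combination heq
    have m := congrArg PadicInt.toZMod e
    simp only [map_add, map_mul, map_pow, map_intCast, map_one, hu0] at m
    exact one_ne_zero (α := ZMod p) (by linear_combination m)
  obtain ⟨Y, rfl⟩ : ∃ Y : ℤ_[p], (Y : ℚ_[p]) = y := ⟨⟨y, hy⟩, rfl⟩
  have m1 := congrArg PadicInt.toZMod (show Y ^ 2 + W.a₁ * X * Y + W.a₃ * Y =
    X ^ 3 + W.a₂ * X ^ 2 + W.a₄ * X + W.a₆ from PadicInt.ext (by push_cast; exact heq))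
  have m2 := congrArg PadicInt.toZMod (show f = 2 * Y + W.a₁ * X + W.a₃ from
    PadicInt.ext (by push_cast; exact hf))
  have m3 := congrArg PadicInt.toZMod (show g =
    3 * X ^ 4 + W.b₂ * X ^ 3 + 3 * W.b₄ * X ^ 2 + 3 * W.b₆ * X + W.b₈ from
    PadicInt.ext (by push_cast; exact hg))
  simp only [map_add, map_mul, map_pow, map_intCast, map_ofNat, hf0, hg0] at m1 m2 m3
  rw [← ZMod.intCast_zmod_eq_zero_iff_dvd]
  by_contra hΔ
  refine not_nonsingular_of_ψ₂_of_Ψ₃ (W.map (Int.castRingHom (ZMod p)))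
    (x := PadicInt.toZMod X) (y := PadicInt.toZMod Y) ?_ ?_
    ((Affine.equation_iff_nonsingular_of_Δ_ne_zero ?_).mp ?_)
  · simpa using m2.symm
  · simpa only [map_b₂, map_b₄, map_b₆, map_b₈, eq_intCast] using m3.symm
  · simpa only [map_Δ, eq_intCast] using hΔ
  · simpa [Affine.equation_iff] using m1

/-- **Silverman, Proposition 18 (integrality of the normalizing constant)**: Let `E` be an
elliptic curve over `ℚ` given by a Weierstrass equation with coefficients in `ℤ`, let
`P = (x, y) ∈ E(ℚ)` be an affine point, and let `γ ∈ ℚ*` be such that `γ^{n²−1}·F_n(P) ∈ ℤ`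
for all `n ≥ 1`. If `p` is a prime not dividing the discriminant of the Weierstrass equation
(good reduction at `p`), then `ord_p(γ) ≥ 0`, i.e. `‖γ‖_p ≤ 1`. -/
theorem stmt13 (W : WeierstrassCurve ℤ) (hΔ : W.Δ ≠ 0)
    {x y : ℚ} (hP : (W.map (Int.castRingHom ℚ)).toAffine.Nonsingular x y)
    (γ : ℚ) (hγ : γ ≠ 0)
    (hint : ∀ n : ℕ, 1 ≤ n → ∃ w : ℤ,
      γ ^ (n ^ 2 - 1) * ((W.map (Int.castRingHom ℚ)).ψ n).evalEval x y = (w : ℚ))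
    (p : ℕ) [Fact p.Prime] (hgood : ¬ (p : ℤ) ∣ W.Δ) :
    ‖(γ : ℚ_[p])‖ ≤ 1 := by
  by_contra! hlt
  refine hgood (Δ_dvd_of_norm_lt_one W p (x := x) (y := y) ?_ ?_ ?_)
  · have h := (Affine.equation_iff ..).mp hP.1
    simp only [map_a₁, map_a₂, map_a₃, map_a₄, map_a₆, eq_intCast] at h
    exact_mod_cast h
  · obtain ⟨w, hw⟩ := hint 2 (by norm_num)
    refine norm_lt_one_of_norm_pow_mul_le_one (k := 2 ^ 2 - 1) (by norm_num) hlt ?_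
    rw [Nat.cast_ofNat, ψ_two, ψ₂, Affine.evalEval_polynomialY] at hw
    simp only [map_a₁, map_a₃, eq_intCast] at hw
    replace hw := congrArg (Rat.cast : ℚ → ℚ_[p]) hw
    push_cast at hw ⊢
    exact hw ▸ Padic.norm_int_le_one w
  · obtain ⟨w, hw⟩ := hint 3 (by norm_num)
    refine norm_lt_one_of_norm_pow_mul_le_one (k := 3 ^ 2 - 1) (by norm_num) hlt ?_
    rw [Nat.cast_ofNat, ψ_three, evalEval_C, Ψ₃] at hw
    simp only [map_b₂, map_b₄, map_b₆, map_b₈, eq_intCast, eval_add, eval_mul, eval_pow, eval_X,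
      eval_ofNat, eval_intCast, map_intCast] at hw
    replace hw := congrArg (Rat.cast : ℚ → ℚ_[p]) hw
    push_cast at hw ⊢
    exact hw ▸ Padic.norm_int_le_one w
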